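/- Let g : ℝⁿ → ℝ be convex, let X ⊆ ℝⁿ be a nonempty compact set, let ε > 0, and let β > 0 be such that ‖(−c,1)‖ ≤ β for all x ∈ X and all c ∈ ∂g(x) (Euclidean norm on ℝ^{n+1}). Then there is NO infinite sequence of nonempty bounded sets A^0 ⊇ A^1 ⊇ A^2 ⊇ ⋯ in ℝ^{n+1} together with points v^k = (x^k, y^k) ∈ A^k, subgradients c^k ∈ ∂g(x^k), such that for every k: x^k ∈ X, g(x^k) − y^k > ε, and A^{k+1} ⊆ A^k ∩ H_k, where H_k := {(x,t) : t − (c^k)ᵀx ≥ g(x^k) − (c^k)ᵀx^k}. In other words, any such cutting process must stop after finitely many iterations. -/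

import Mathlib

open Set
open scoped RealInnerProductSpace

/-- `ℝⁿ × ℝ` equipped with the Euclidean (ℓ²) norm, i.e. `ℝ^{n+1}`. -/
abbrev EucProd (n : ℕ) := WithLp 2 ((EuclideanSpace ℝ (Fin n)) × ℝ)

/-- Convert a point of `ℝ^{n+1}` to a pair `(x,t) ∈ ℝⁿ × ℝ`. -/
noncomputable def toProd {n : ℕ} (p : EucProd n) : (EuclideanSpace ℝ (Fin n)) × ℝ :=
  WithLp.equiv 2 _ p

/-- Build a point of `ℝ^{n+1}` from a pair `(x,t) ∈ ℝⁿ × ℝ`. -/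
noncomputable def ofProd {n : ℕ} (p : (EuclideanSpace ℝ (Fin n)) × ℝ) : EucProd n :=
  (WithLp.equiv 2 _).symm p

/-- The subdifferential `∂g(x)` of `g` at `x`. -/
def subgrad {n : ℕ} (g : EuclideanSpace ℝ (Fin n) → ℝ) (x : EuclideanSpace ℝ (Fin n)) :
    Set (EuclideanSpace ℝ (Fin n)) :=
  {c | ∀ z, g x + ⟪c, z - x⟫ ≤ g z}

theorem inner_ofProd {n : ℕ} (p q : EuclideanSpace ℝ (Fin n) × ℝ) :
    ⟪ofProd p, ofProd q⟫ = ⟪p.1, q.1⟫ + p.2 * q.2 := by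
  simp [ofProd, WithLp.prod_inner_apply, mul_comm]

theorem ofProd_sub {n : ℕ} (p q : EuclideanSpace ℝ (Fin n) × ℝ) :
    ofProd p - ofProd q = ofProd (p - q) := rfl

/-- A bounded sequence in a proper metric space is not uniformly separated. -/
theorem exists_lt_dist_lt_of_isBounded {α : Type*} [PseudoMetricSpace α] [ProperSpace α]
    {s : Set α} (hs : Bornology.IsBounded s) {u : ℕ → α} (hu : ∀ k, u k ∈ s)
    {δ : ℝ} (hδ : 0 < δ) : ∃ k m, k < m ∧ dist (u m) (u k) < δ := by
  obtain ⟨a, -, φ, hφ, hlim⟩ := tendsto_subseq_of_bounded hs hu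
  obtain ⟨N, hN⟩ := Metric.cauchySeq_iff'.1 hlim.cauchySeq δ hδ
  exact ⟨φ N, φ (N + 1), hφ N.lt_succ_self, hN (N + 1) N.le_succ⟩

/-- Given convex `g : ℝⁿ → ℝ`, a nonempty compact `X ⊆ ℝⁿ`, `ε > 0` and a
bound `β` on `‖(-c,1)‖` over subgradients `c ∈ ∂g(x)` for `x ∈ X`, there is no infinite
sequence of nonempty bounded sets `A^0 ⊇ A^1 ⊇ ⋯` with points `v^k = (x^k,y^k) ∈ A^k`,
`x^k ∈ X`, subgradients `c^k ∈ ∂g(x^k)`, such that `g(x^k) - y^k > ε` and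
`A^{k+1} ⊆ A^k ∩ H_k`, where `H_k = {(x,t) : t - (c^k)ᵀx ≥ g(x^k) - (c^k)ᵀx^k}`:
any such cutting process stops after finitely many iterations. -/
theorem no_infinite_cutting_sequence {n : ℕ}
    (g : EuclideanSpace ℝ (Fin n) → ℝ) (hg : ConvexOn ℝ Set.univ g)
    (X : Set (EuclideanSpace ℝ (Fin n))) (hXne : X.Nonempty) (hXcomp : IsCompact X)
    (ε β : ℝ) (hε : 0 < ε) (hβ : 0 < β)
    (hβbound : ∀ x ∈ X, ∀ c ∈ subgrad g x, ‖ofProd (-c, (1 : ℝ))‖ ≤ β) :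
    ¬ ∃ (A : ℕ → Set (EucProd n)) (x : ℕ → EuclideanSpace ℝ (Fin n)) (y : ℕ → ℝ)
        (c : ℕ → EuclideanSpace ℝ (Fin n)),
      (∀ k, (A k).Nonempty) ∧
      (∀ k, Bornology.IsBounded (A k)) ∧
      (∀ k, ofProd (x k, y k) ∈ A k) ∧
      (∀ k, x k ∈ X) ∧
      (∀ k, c k ∈ subgrad g (x k)) ∧
      (∀ k, g (x k) - y k > ε) ∧
      (∀ k, A (k + 1) ⊆ A k ∩
        {p | g (x k) - ⟪c k, x k⟫ ≤ (toProd p).2 - ⟪c k, (toProd p).1⟫}) := by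
  rintro ⟨A, x, y, c, -, hbdd, hmem, hxX, hc, hgap, hcut⟩
  have hanti : Antitone A := antitone_nat_of_succ_le fun k => (hcut k).trans inter_subset_left
  obtain ⟨k, m, hkm, hdist⟩ := exists_lt_dist_lt_of_isBounded (hbdd 0)
    (fun k => hanti (Nat.zero_le k) (hmem k)) (div_pos hε hβ)
  have hH : g (x k) - ⟪c k, x k⟫ ≤ y m - ⟪c k, x m⟫ := (hcut k (hanti hkm (hmem m))).2
  rw [dist_eq_norm, lt_div_iff₀ hβ] at hdist
  have hcs := real_inner_le_norm (ofProd (-c k, (1 : ℝ))) (ofProd (x m, y m) - ofProd (x k, y k))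
  have hle := mul_le_mul_of_nonneg_right (hβbound _ (hxX k) _ (hc k))
    (norm_nonneg (ofProd (x m, y m) - ofProd (x k, y k)))
  have hinner : ⟪ofProd (-c k, (1 : ℝ)), ofProd (x m, y m) - ofProd (x k, y k)⟫
      = (y m - ⟪c k, x m⟫) - (y k - ⟪c k, x k⟫) := by
    rw [ofProd_sub, inner_ofProd]
    simp only [Prod.mk_sub_mk, inner_neg_left, inner_sub_right]
    ring
  linarith [hgap k]
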